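/- arXiv:1708.07168 — 7 statements merged into one kernel-verified Lean document; each statement's English description precedes it below -/
import Mathlib

section
/- Let f, g : ℝ² → ℝ be affine functions, f(x,y) = a₁x + a₂y + a₃ and g(x,y) = b₁x + b₂y + b₃, with (a₁,a₂) ≠ (0,0) and (b₁,b₂) ≠ (0,0). If f(p)·g(p) ≥ 0 for every p ∈ ℝ², then the zero sets coincide: {p ∈ ℝ² : f(p) = 0} = {p ∈ ℝ² : g(p) = 0}. -/
/-- A quadratic polynomial without constant term that is nonnegative on `ℝ` has no linear term. -/
lemma linear_coeff_eq_zero_of_forall_nonneg {m n : ℝ} (h : ∀ t : ℝ, 0 ≤ t * m + t ^ 2 * n) :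
    m = 0 := by
  have hk : 0 < |n| + 1 := by positivity
  have key : -m / (|n| + 1) * m + (-m / (|n| + 1)) ^ 2 * n
      = m ^ 2 * (n - (|n| + 1)) / (|n| + 1) ^ 2 := by
    field_simp
    ring
  have hq := h (-m / (|n| + 1))
  rw [key, le_div_iff₀ (by positivity), zero_mul] at hq
  exact pow_eq_zero_iff two_ne_zero |>.mp (by nlinarith [le_abs_self n, sq_nonneg m])

/-- If the product of two affine functions on the plane is nonnegative and the first one is
nonconstant, then the second one vanishes wherever the first one does. -/
lemma affine_eq_zero_of_mul_nonneg {a1 a2 a3 b1 b2 b3 x y : ℝ} (ha : (a1, a2) ≠ (0, 0))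
    (h : ∀ u v : ℝ, 0 ≤ (a1 * u + a2 * v + a3) * (b1 * u + b2 * v + b3))
    (h0 : a1 * x + a2 * y + a3 = 0) : b1 * x + b2 * y + b3 = 0 := by
  have hA : a1 ^ 2 + a2 ^ 2 ≠ 0 := fun hs =>
    ha (Prod.ext (by dsimp only; nlinarith [sq_nonneg a1, sq_nonneg a2])
      (by dsimp only; nlinarith [sq_nonneg a1, sq_nonneg a2]))
  refine (mul_eq_zero.mp (linear_coeff_eq_zero_of_forall_nonneg
    (m := (a1 ^ 2 + a2 ^ 2) * (b1 * x + b2 * y + b3))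
    (n := (a1 ^ 2 + a2 ^ 2) * (b1 * a1 + b2 * a2)) fun t => ?_)).resolve_left hA
  convert h (x + t * a1) (y + t * a2) using 1
  linear_combination (-(b1 * (x + t * a1) + b2 * (y + t * a2) + b3)) * h0

/-- Lemma `retasiguais`: if the product of two affine functions on the plane is
everywhere nonnegative, their zero sets (straight lines) coincide. -/
theorem stmt_0 (a1 a2 a3 b1 b2 b3 : ℝ)
    (ha : (a1, a2) ≠ (0, 0)) (hb : (b1, b2) ≠ (0, 0))
    (f g : ℝ × ℝ → ℝ)
    (hf : ∀ p : ℝ × ℝ, f p = a1 * p.1 + a2 * p.2 + a3)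
    (hg : ∀ p : ℝ × ℝ, g p = b1 * p.1 + b2 * p.2 + b3)
    (h : ∀ p : ℝ × ℝ, f p * g p ≥ 0) :
    {p : ℝ × ℝ | f p = 0} = {p : ℝ × ℝ | g p = 0} := by
  simp only [hf, hg] at h ⊢
  ext p
  exact ⟨affine_eq_zero_of_mul_nonneg ha fun u v => h (u, v),
    affine_eq_zero_of_mul_nonneg hb fun u v => (h (u, v)).trans_eq (mul_comm _ _)⟩
end

section
/- Let X : ℝ³ → ℝ³ be the affine vector field X(x,y,z) = (a₁₁x + a₁₂y + a₁₃z + b₁, a₂₁x + a₂₂y + a₂₃z + b₂, y + a₃₃z) with a₂₁ ≠ 0, and h(x,y,z) = z. Define Xh(p) as the third component of X(p), X²h(p) = ∇(Xh)(p)·X(p) = a₂₁x + (a₂₂+a₃₃)y + (a₂₃+a₃₃²)z + b₂, and X³h(p) = ∇(X²h)(p)·X(p). Then there is a unique point p on the line L = {y = z = 0} with X²h(p) = 0, namely p = (−b₂/a₂₁, 0, 0), and at this point X³h(p) = a₂₁b₁ − a₁₁b₂. In particular p is a cusp of X (X³h(p) ≠ 0) if a₂₁b₁ − a₁₁b₂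 ≠ 0, and p is a singular point of X if a₂₁b₁ − a₁₁b₂ = 0. -/
/-- Statement (3) of the tangency-line lemma: if `a₂₁ ≠ 0` there is a unique point
`p = (-b₂/a₂₁, 0, 0)` on the line `L = {y = z = 0}` with `X²h(p) = 0`, and at this
point `X³h(p) = a₂₁b₁ - a₁₁b₂`; so `p` is a cusp when `a₂₁b₁ - a₁₁b₂ ≠ 0` and a
singular point of `X` when `a₂₁b₁ - a₁₁b₂ = 0`. -/
theorem stmt_3 (a11 a12 a13 b1 a21 a22 a23 b2 a33 : ℝ) (ha21 : a21 ≠ 0)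
    (X : ℝ × ℝ × ℝ → ℝ × ℝ × ℝ)
    (hX : ∀ p : ℝ × ℝ × ℝ, X p =
      (a11 * p.1 + a12 * p.2.1 + a13 * p.2.2 + b1,
       a21 * p.1 + a22 * p.2.1 + a23 * p.2.2 + b2,
       p.2.1 + a33 * p.2.2))
    (X2h X3h : ℝ × ℝ × ℝ → ℝ)
    (hX2h : ∀ p, X2h p =
      a21 * p.1 + (a22 + a33) * p.2.1 + (a23 + a33 ^ 2) * p.2.2 + b2)
    (hX3h : ∀ p, X3h p =
      a21 * (X p).1 + (a22 + a33) * (X p).2.1 + (a23 + a33 ^ 2) * (X p).2.2) :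
    (∃! x : ℝ, X2h (x, 0, 0) = 0) ∧
    X2h (-b2 / a21, 0, 0) = 0 ∧
    X3h (-b2 / a21, 0, 0) = a21 * b1 - a11 * b2 ∧
    (a21 * b1 - a11 * b2 ≠ 0 → X3h (-b2 / a21, 0, 0) ≠ 0) ∧
    (a21 * b1 - a11 * b2 = 0 → X (-b2 / a21, 0, 0) = (0, 0, 0)) := by
  have hx : a21 * (-b2 / a21) = -b2 := mul_div_cancel₀ _ ha21
  have h2 : X2h (-b2 / a21, 0, 0) = 0 := by
    simp [hX2h, hx]
  have h3 : X3h (-b2 / a21, 0, 0) = a21 * b1 - a11 * b2 := by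
    simp only [hX3h, hX]
    linear_combination (a11 + a22 + a33) * hx
  refine ⟨⟨-b2 / a21, h2, fun x h => ?_⟩, h2, h3, fun h => h3 ▸ h, fun h => ?_⟩
  · simp only [hX2h] at h
    rw [eq_div_iff ha21]
    linear_combination h
  · have h1 : a11 * (-b2 / a21) + b1 = 0 := by
      apply mul_left_cancel₀ ha21
      linear_combination a11 * hx + h
    simp [hX, hx, h1]
end

section
/- Let X : ℝ³ → ℝ³ be the affine vector field X(x,y,z) = (a₁₁x + a₁₂y + a₁₃z + b₁, a₂₂y + a₂₃z + b₂, y + a₃₃z) with b₂ < 0. Define the linear map φ(x,y,z) = (x − (b₁/b₂)y − ((b₁a₁₁ − b₁a₂₂ + a₁₂b₂)/b₂)z, y + a₃₃z, −b₂z). Then φ is an invertible linear map that maps the plane {z = 0} onto itself and the half-space {z > 0} onto itself, and there exist real numbers a, b, c, d such that for every p = (p₁,p₂,p₃) ∈ ℝ³, φ(X(φ⁻¹(p))) = −b₂ · (a·p₁ + b·p₃, c·p₂ + d·p₃ − 1, p₂). In other words, after the linear change of variables φ and the time rescaling t ↦ −t/b₂, the vector field X takes the canonical form (ax + bz, cy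 + dz − 1, y). -/
/-- Canonical form proposition: for `b₂ < 0`, the explicit linear change of variables
`φ` is invertible, preserves the plane `{z = 0}` and the half-space `{z > 0}`,
and conjugates `X` (up to the constant time rescaling `-b₂`) to the canonical form
`(ax + bz, cy + dz - 1, y)`. -/
theorem stmt_4 (a11 a12 a13 b1 a22 a23 b2 a33 : ℝ) (hb2 : b2 < 0)
    (X : ℝ × ℝ × ℝ → ℝ × ℝ × ℝ)
    (hX : ∀ p : ℝ × ℝ × ℝ, X p =
      (a11 * p.1 + a12 * p.2.1 + a13 * p.2.2 + b1,
       a22 * p.2.1 + a23 * p.2.2 + b2,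
       p.2.1 + a33 * p.2.2))
    (φ : ℝ × ℝ × ℝ → ℝ × ℝ × ℝ)
    (hφ : ∀ p : ℝ × ℝ × ℝ, φ p =
      (p.1 - (b1 / b2) * p.2.1 - ((b1 * a11 - b1 * a22 + a12 * b2) / b2) * p.2.2,
       p.2.1 + a33 * p.2.2,
       -b2 * p.2.2)) :
    IsLinearMap ℝ φ ∧ Function.Bijective φ ∧
    φ '' {p : ℝ × ℝ × ℝ | p.2.2 = 0} = {p : ℝ × ℝ × ℝ | p.2.2 = 0} ∧
    φ '' {p : ℝ × ℝ × ℝ | 0 < p.2.2} = {p : ℝ × ℝ × ℝ | 0 < p.2.2} ∧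
    ∃ ψ : ℝ × ℝ × ℝ → ℝ × ℝ × ℝ, Function.LeftInverse ψ φ ∧ Function.RightInverse ψ φ ∧
      ∃ a b c d : ℝ, ∀ p : ℝ × ℝ × ℝ,
        φ (X (ψ p)) =
          (-b2) • ((a * p.1 + b * p.2.2, c * p.2.1 + d * p.2.2 - 1, p.2.1) : ℝ × ℝ × ℝ) := by
  have hb : b2 ≠ 0 := hb2.ne
  set k : ℝ := (b1 * a11 - b1 * a22 + a12 * b2) / b2 with hk
  let ψ : ℝ × ℝ × ℝ → ℝ × ℝ × ℝ := fun p =>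
    (p.1 + (b1 / b2) * (p.2.1 + a33 * p.2.2 / b2) - k * p.2.2 / b2,
     p.2.1 + a33 * p.2.2 / b2,
     -p.2.2 / b2)
  have hl : Function.LeftInverse ψ φ := by
    rintro ⟨x, y, z⟩
    simp only [hφ, ψ, Prod.mk.injEq]
    refine ⟨?_, ?_, ?_⟩ <;> field_simp <;> ring
  have hr : Function.RightInverse ψ φ := by
    rintro ⟨x, y, z⟩
    simp only [hφ, ψ, Prod.mk.injEq]
    refine ⟨?_, ?_, ?_⟩ <;> field_simp <;> ring
  have himage (S : Set ℝ) (hS : ∀ z, -b2 * z ∈ S ↔ z ∈ S) :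
      φ '' {p | p.2.2 ∈ S} = {p | p.2.2 ∈ S} := by
    rw [Set.image_eq_preimage_of_inverse hl hr]
    ext p
    have hp : (p.2.2 : ℝ) = -b2 * (ψ p).2.2 := by
      simp only [ψ]
      field_simp
    simp only [Set.mem_preimage, Set.mem_ofPred_eq]
    rw [hp, hS]
  refine ⟨⟨?_, ?_⟩, ⟨hl.injective, hr.surjective⟩, himage {0} ?_, himage (Set.Ioi 0) ?_,
    ψ, hl, hr, -a11 / b2, (a11 * k + a13 - b1 * a23 / b2 - k * a33) / b2 ^ 2,
    -(a22 + a33) / b2, (a23 - a22 * a33) / b2 ^ 2, ?_⟩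
  · rintro ⟨x, y, z⟩ ⟨x', y', z'⟩
    simp only [hφ, Prod.mk_add_mk, Prod.mk.injEq]
    refine ⟨?_, ?_, ?_⟩ <;> ring
  · rintro r ⟨x, y, z⟩
    simp only [hφ, Prod.smul_mk, smul_eq_mul, Prod.mk.injEq]
    refine ⟨?_, ?_, ?_⟩ <;> ring
  · intro z
    simp [hb]
  · intro z
    exact mul_pos_iff_of_pos_left (neg_pos.mpr hb2)
  · rintro ⟨x, y, z⟩
    simp only [hX, hφ, ψ, Prod.smul_mk, smul_eq_mul, Prod.mk.injEq]
    refine ⟨?_, ?_, ?_⟩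
    · rw [hk]
      field_simp
      ring
    · field_simp
      ring
    · field_simp
      ring
end

section
/- Let a, b, c, d ∈ ℝ and let x, y, z : ℝ → ℝ be differentiable functions satisfying x'(t) = a·x(t) + b·z(t), y'(t) = c·y(t) + d·z(t) − 1, z'(t) = y(t) for all t. Define u(t) = a(a² − ac − d)·x(t) + ab·y(t) + ab(a − c)·z(t) − b. Then u(t) = e^{at}·u(0) for all t ∈ ℝ. In particular, if z(0) = z(τ) = 0 then e^{aτ}·(a(a² − ac − d)x(0) + ab·y(0) − b) = a(a² − ac − d)x(τ) + ab·y(τ) − b. -/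
/-- A real solution of `u' = a u` is `u t = e^{at} u 0`. -/
theorem eq_exp_mul_of_hasDerivAt {a : ℝ} {u : ℝ → ℝ}
    (hu : ∀ t, HasDerivAt u (a * u t) t) (t : ℝ) :
    u t = Real.exp (a * t) * u 0 := by
  have hderiv : ∀ s, HasDerivAt (fun r => Real.exp (-(a * r)) * u r) 0 s := fun s => by
    have hexp : HasDerivAt (fun r => Real.exp (-(a * r))) (Real.exp (-(a * s)) * -(a * 1)) s :=
      (((hasDerivAt_id s).const_mul a).neg).exp
    exact (hexp.mul (hu s)).congr_deriv (by ring)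
  have hconst := is_const_of_deriv_eq_zero (fun s => (hderiv s).differentiableAt)
    (fun s => (hderiv s).deriv) t 0
  simp only [mul_zero, neg_zero, Real.exp_zero, one_mul] at hconst
  rw [← hconst, ← mul_assoc, ← Real.exp_add, add_neg_cancel, Real.exp_zero, one_mul]

/-- For the canonical system `x' = ax + bz`, `y' = cy + dz - 1`, `z' = y`, the
quantity `u(t) = a(a² - ac - d)x(t) + ab·y(t) + ab(a - c)z(t) - b` evolves as
`u(t) = e^{at} u(0)`; in particular, if `z(0) = z(τ) = 0` then
`e^{aτ}(a(a² - ac - d)x(0) + ab·y(0) - b) = a(a² - ac - d)x(τ) + ab·y(τ) - b`. -/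
theorem stmt_8 (a b c d : ℝ) (x y z : ℝ → ℝ)
    (hx : ∀ t, HasDerivAt x (a * x t + b * z t) t)
    (hy : ∀ t, HasDerivAt y (c * y t + d * z t - 1) t)
    (hz : ∀ t, HasDerivAt z (y t) t)
    (u : ℝ → ℝ)
    (hu : ∀ t, u t = a * (a ^ 2 - a * c - d) * x t + a * b * y t
      + a * b * (a - c) * z t - b) :
    (∀ t : ℝ, u t = Real.exp (a * t) * u 0) ∧
    ∀ τ : ℝ, z 0 = 0 → z τ = 0 →
      Real.exp (a * τ) * (a * (a ^ 2 - a * c - d) * x 0 + a * b * y 0 - b) =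
        a * (a ^ 2 - a * c - d) * x τ + a * b * y τ - b := by
  have hderiv : ∀ t, HasDerivAt u (a * u t) t := fun t => by
    rw [funext hu]
    exact (((((hx t).const_mul (a * (a ^ 2 - a * c - d))).add
      ((hy t).const_mul (a * b))).add
      ((hz t).const_mul (a * b * (a - c)))).sub_const b).congr_deriv (by ring)
  have hexp := eq_exp_mul_of_hasDerivAt hderiv
  refine ⟨hexp, fun τ h0 hτ => ?_⟩
  simpa [hu, h0, hτ] using (hexp τ).symm
end

section
/- Let d < 0 and set α = √(−d). Let y, z : ℝ → ℝ be differentiable with y'(t) = d·z(t) − 1 and z'(t) = y(t) for all t, and suppose z(0) = 0 and z(τ) = 0 for some τ ∈ ℝ. Writing y₀ = y(0) and y₁ = y(τ), one has cos(ατ)·(α²y₀² + 1) = α²y₀y₁ + 1 and sin(ατ)·(α²y₀² + 1) = α(y₀ − y₁). -/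
/-- Boundary-value relations for the center case `Ce`: for the system
`y' = dz - 1`, `z' = y` with `d < 0`, `α = √(-d)`, and `z(0) = z(τ) = 0`, one has
`cos(ατ)(α²y₀² + 1) = α²y₀y₁ + 1` and `sin(ατ)(α²y₀² + 1) = α(y₀ - y₁)`. -/
theorem stmt_10 (d : ℝ) (hd : d < 0) (α : ℝ) (hα : α = Real.sqrt (-d))
    (y z : ℝ → ℝ)
    (hy : ∀ t, HasDerivAt y (d * z t - 1) t)
    (hz : ∀ t, HasDerivAt z (y t) t)
    (τ : ℝ) (hz0 : z 0 = 0) (hzτ : z τ = 0) :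
    Real.cos (α * τ) * (α ^ 2 * (y 0) ^ 2 + 1) = α ^ 2 * y 0 * y τ + 1 ∧
    Real.sin (α * τ) * (α ^ 2 * (y 0) ^ 2 + 1) = α * (y 0 - y τ) := by
  have hd' : d = -α ^ 2 := by
    rw [hα, Real.sq_sqrt (by linarith)]
    ring
  subst hd'
  have hs (t : ℝ) : HasDerivAt (fun t => Real.sin (α * t)) (Real.cos (α * t) * α) t := by
    simpa using ((hasDerivAt_id t).const_mul α).sin
  have hc (t : ℝ) : HasDerivAt (fun t => Real.cos (α * t)) (-Real.sin (α * t) * α) t := by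
    simpa using ((hasDerivAt_id t).const_mul α).cos
  have hu (t : ℝ) : HasDerivAt (fun t => α ^ 2 * z t + 1) (α ^ 2 * y t) t :=
    ((hz t).const_mul (α ^ 2)).add_const 1
  have hv (t : ℝ) : HasDerivAt (fun t => α * y t) (α * (-α ^ 2 * z t - 1)) t :=
    (hy t).const_mul α
  have hA (t : ℝ) : HasDerivAt (fun t => (α ^ 2 * z t + 1) * Real.cos (α * t)
      - α * y t * Real.sin (α * t)) 0 t := by
    refine (((hu t).mul (hc t)).sub ((hv t).mul (hs t))).congr_deriv ?_
    ring
  have hB (t : ℝ) : HasDerivAt (fun t => (α ^ 2 * z t + 1) * Real.sin (α * t)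
      + α * y t * Real.cos (α * t)) 0 t := by
    refine (((hu t).mul (hs t)).add ((hv t).mul (hc t))).congr_deriv ?_
    ring
  have h₁ : Real.cos (α * τ) - α * y τ * Real.sin (α * τ) = 1 := by
    simpa [hz0, hzτ] using is_const_of_deriv_eq_zero
      (fun t => (hA t).differentiableAt) (fun t => (hA t).deriv) τ 0
  have h₂ : Real.sin (α * τ) + α * y τ * Real.cos (α * τ) = α * y 0 := by
    simpa [hz0, hzτ] using is_const_of_deriv_eq_zero
      (fun t => (hB t).differentiableAt) (fun t => (hB t).deriv) τ 0
  have h := Real.sin_sq_add_cos_sq (α * τ)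
  have h₃ : Real.cos (α * τ) + α * y 0 * Real.sin (α * τ) = 1 := by
    linear_combination h - Real.cos (α * τ) * h₁ - Real.sin (α * τ) * h₂
  have h₄ : α * y τ = α * y 0 * Real.cos (α * τ) - Real.sin (α * τ) := by
    linear_combination Real.cos (α * τ) * h₂ - Real.sin (α * τ) * h₁ - α * y τ * h
  constructor
  · linear_combination h₃ - α * y 0 * h₄
  · linear_combination α * y 0 * h₃ + h₄
end

section
/- Let c ∈ ℝ, c ≠ 0, and let y, z : ℝ → ℝ be differentiable with y'(t) = c·y(t) − (c²/4)·z(t) − 1 and z'(t) = y(t) for all t, and suppose z(0) = 0 and z(τ) = 0 for some τ ∈ ℝ. Writing y₀ = y(0) and y₁ = y(τ), one has e^{cτ/2}·(c·y₀ − 2) = c·y₁ − 2 and e^{cτ/2}·(4 + cτ·(c·y₀ − 2)) = 4. -/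
theorem eq_of_forall_hasDerivAt_zero {f : ℝ → ℝ} (hf : ∀ t, HasDerivAt f 0 t) (a b : ℝ) :
    f a = f b :=
  is_const_of_deriv_eq_zero (fun t => (hf t).differentiableAt) (fun t => (hf t).deriv) a b

theorem hasDerivAt_exp_neg_mul_div_two (c t : ℝ) :
    HasDerivAt (fun s => Real.exp (-(c * s / 2))) (Real.exp (-(c * t / 2)) * (-(c / 2))) t := by
  have h : HasDerivAt (fun s : ℝ => -(c * s / 2)) (-(c / 2)) t := by
    simpa using (((hasDerivAt_id t).const_mul c).div_const 2).fun_neg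
  exact h.exp


/-- Boundary-value relations for the degenerate node case `Nd`: for the system
`y' = cy - (c²/4)z - 1`, `z' = y` with `c ≠ 0` and `z(0) = z(τ) = 0`, one has
`e^{cτ/2}(cy₀ - 2) = cy₁ - 2` and `e^{cτ/2}(4 + cτ(cy₀ - 2)) = 4`. -/
theorem stmt_11 (c : ℝ) (hc : c ≠ 0)
    (y z : ℝ → ℝ)
    (hy : ∀ t, HasDerivAt y (c * y t - (c ^ 2 / 4) * z t - 1) t)
    (hz : ∀ t, HasDerivAt z (y t) t)
    (τ : ℝ) (hz0 : z 0 = 0) (hzτ : z τ = 0) :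
    Real.exp (c * τ / 2) * (c * y 0 - 2) = c * y τ - 2 ∧
    Real.exp (c * τ / 2) * (4 + c * τ * (c * y 0 - 2)) = 4 := by
  have first_integral : ∀ t,
      Real.exp (-(c * t / 2)) * (c * (y t - c / 2 * z t) - 2) = c * y 0 - 2 := by
    intro t
    have h := eq_of_forall_hasDerivAt_zero
      (f := fun t => Real.exp (-(c * t / 2)) * (c * (y t - c / 2 * z t) - 2)) (fun t => by
        refine ((hasDerivAt_exp_neg_mul_div_two c t).fun_mul
          ((((hy t).fun_sub ((hz t).const_mul (c / 2))).const_mul c).sub_const 2)).congr_deriv ?_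
        ring) t 0
    simpa [hz0] using h
  have second_integral :
      Real.exp (-(c * τ / 2)) * (c ^ 2 * z τ + 4) - c * (c * y 0 - 2) * τ = 4 := by
    have h := eq_of_forall_hasDerivAt_zero
      (f := fun t => Real.exp (-(c * t / 2)) * (c ^ 2 * z t + 4) - c * (c * y 0 - 2) * t)
      (fun t => by
        refine (((hasDerivAt_exp_neg_mul_div_two c t).fun_mul
          (((hz t).const_mul (c ^ 2)).add_const 4)).fun_sub
          ((hasDerivAt_id t).const_mul (c * (c * y 0 - 2)))).congr_deriv ?_
        rw [← first_integral t]
        ring) τ 0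
    simpa [hz0] using h
  have hexp : Real.exp (c * τ / 2) * Real.exp (-(c * τ / 2)) = 1 := by
    rw [← Real.exp_add, add_neg_cancel, Real.exp_zero]
  have h₁ := first_integral τ
  rw [hzτ] at h₁ second_integral
  constructor
  · linear_combination (-Real.exp (c * τ / 2)) * h₁ + (c * y τ - 2) * hexp
  · linear_combination (-Real.exp (c * τ / 2)) * second_integral + 4 * hexp
end

section
/- Let α > 1 and let κ, λ ∈ ℝ with κ·λ < 0. Consider the function g(v) = κ·v^α·(v − 1)² + λ·v·(v^α − 1)² on the open interval (0, 1). If 1 + α²·λ/κ > 0, then g has exactly one zero in (0, 1); if 1 + α²·λ/κ ≤ 0, then g has no zero in (0, 1). -/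
open Set in
lemma sinh_lt_mul_cosh {x : ℝ} (hx : 0 < x) : Real.sinh x < x * Real.cosh x := by
  have hd (y : ℝ) : HasDerivAt (fun y => y * Real.cosh y - Real.sinh y) (y * Real.sinh y) y := by
    refine (((hasDerivAt_id y).mul (Real.hasDerivAt_cosh y)).sub
      (Real.hasDerivAt_sinh y)).congr_deriv ?_
    simp
  have hm : StrictMonoOn (fun y => y * Real.cosh y - Real.sinh y) (Ici (0 : ℝ)) := by
    refine strictMonoOn_of_deriv_pos (convex_Ici 0)
      (fun y _ => (hd y).continuousAt.continuousWithinAt) fun y hy => ?_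
    rw [interior_Ici] at hy
    rw [(hd y).deriv]
    exact mul_pos hy (Real.sinh_pos_iff.2 hy)
  have h := hm self_mem_Ici hx.le hx
  simp at h
  exact h

open Set in
lemma mul_sinh_lt_sinh_mul {a x : ℝ} (ha : 1 < a) (hx : 0 < x) :
    a * Real.sinh x < Real.sinh (a * x) := by
  have hd (y : ℝ) : HasDerivAt (fun y => Real.sinh (a * y) - a * Real.sinh y)
      (a * (Real.cosh (a * y) - Real.cosh y)) y := by
    refine (((hasDerivAt_const_mul a (x := y)).sinh).sub
      ((Real.hasDerivAt_sinh y).const_mul a)).congr_deriv ?_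
    ring
  have hm : StrictMonoOn (fun y => Real.sinh (a * y) - a * Real.sinh y) (Ici (0 : ℝ)) := by
    refine strictMonoOn_of_deriv_pos (convex_Ici 0)
      (fun y _ => (hd y).continuousAt.continuousWithinAt) fun y hy => ?_
    rw [interior_Ici, mem_Ioi] at hy
    rw [(hd y).deriv]
    refine mul_pos (by linarith) (sub_pos.2 (Real.cosh_lt_cosh.2 ?_))
    rw [abs_of_pos hy, abs_of_pos (by positivity)]
    nlinarith
  have h := hm self_mem_Ici hx.le hx
  simp at h
  exact h

open Set in
lemma sinh_mul_cosh_lt {a x : ℝ} (ha : 1 < a) (hx : 0 < x) :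
    Real.sinh (a * x) * Real.cosh x < a * Real.cosh (a * x) * Real.sinh x := by
  have hd (y : ℝ) : HasDerivAt
      (fun y => a * Real.cosh (a * y) * Real.sinh y - Real.sinh (a * y) * Real.cosh y)
      ((a ^ 2 - 1) * (Real.sinh (a * y) * Real.sinh y)) y := by
    refine (((((hasDerivAt_const_mul a (x := y)).cosh).const_mul a).mul
      (Real.hasDerivAt_sinh y)).sub
      (((hasDerivAt_const_mul a (x := y)).sinh).mul (Real.hasDerivAt_cosh y))).congr_deriv ?_
    ring
  have hm : StrictMonoOn
      (fun y => a * Real.cosh (a * y) * Real.sinh y - Real.sinh (a * y) * Real.cosh y)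
      (Ici (0 : ℝ)) := by
    refine strictMonoOn_of_deriv_pos (convex_Ici 0)
      (fun y _ => (hd y).continuousAt.continuousWithinAt) fun y hy => ?_
    rw [interior_Ici, mem_Ioi] at hy
    rw [(hd y).deriv]
    exact mul_pos (by nlinarith)
      (mul_pos (Real.sinh_pos_iff.2 (by positivity)) (Real.sinh_pos_iff.2 hy))
  have h := hm self_mem_Ici hx.le hx
  simp at h
  exact h

open Set in
lemma strictMonoOn_sinh_mul_div_sinh {a : ℝ} (ha : 1 < a) :
    StrictMonoOn (fun x => Real.sinh (a * x) / Real.sinh x) (Ioi (0 : ℝ)) := by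
  have hd (y : ℝ) (hy : 0 < y) := ((hasDerivAt_const_mul a (x := y)).sinh).div
    (Real.hasDerivAt_sinh y) (Real.sinh_pos_iff.2 hy).ne'
  refine strictMonoOn_of_deriv_pos (convex_Ioi 0)
    (fun y hy => (hd y hy).continuousAt.continuousWithinAt) fun y hy => ?_
  rw [interior_Ioi, mem_Ioi] at hy
  have h := (hd y hy).deriv
  simp only [Pi.div_def] at h
  rw [h]
  have := Real.sinh_pos_iff.2 hy
  have := sinh_mul_cosh_lt ha hy
  exact div_pos (by linarith) (by positivity)

open Set in
lemma exists_sinh_mul_eq {a c : ℝ} (ha : 1 < a) (hc : a < c) :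
    ∃ x, 0 < x ∧ Real.sinh (a * x) = c * Real.sinh x := by
  have hlow : ∃ x, 0 < x ∧ Real.sinh (a * x) - c * Real.sinh x < 0 := by
    have hcont : Continuous fun x => a * Real.cosh (a * x) := by fun_prop
    have hev : ∀ᶠ x in nhds (0 : ℝ), a * Real.cosh (a * x) < c :=
      hcont.continuousAt.eventually_lt_const (by simpa using hc)
    obtain ⟨x, hx, hx0⟩ := ((hev.filter_mono nhdsWithin_le_nhds).and
      (self_mem_nhdsWithin (a := (0 : ℝ)) (s := Ioi 0))).exists
    have h1 := sinh_lt_mul_cosh (show 0 < a * x by positivity)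
    have h2 := Real.self_lt_sinh_iff.2 hx0
    exact ⟨x, hx0, by nlinarith⟩
  have hhigh : ∃ x, 0 < x ∧ 0 < Real.sinh (a * x) - c * Real.sinh x := by
    have ha' : 0 < a - 1 := by linarith
    have hc' : 0 < c := by linarith
    refine ⟨c / (a - 1), by positivity, ?_⟩
    set x := c / (a - 1) with hx
    have hx0 : 0 < x := by positivity
    have hax : a * x = c + x := by rw [hx]; field_simp; ring
    rw [hax, Real.sinh_add]
    have h1 := Real.self_lt_sinh_iff.2 hc'
    have h2 := Real.sinh_pos_iff.2 hx0
    have h3 := Real.sinh_lt_cosh x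
    have h4 := Real.cosh_pos c
    nlinarith [mul_pos h4 h2, mul_pos (sub_pos.2 h1) h2, mul_pos (hc'.trans h1) (sub_pos.2 h3)]
  obtain ⟨x, hx, hfx⟩ := hlow
  obtain ⟨y, hy, hfy⟩ := hhigh
  obtain ⟨z, hz, hfz⟩ := isPreconnected_Ioi.intermediate_value (s := Ioi (0 : ℝ)) hx hy
    (f := fun x => Real.sinh (a * x) - c * Real.sinh x) (by fun_prop) ⟨hfx.le, hfy.le⟩
  exact ⟨z, hz, sub_eq_zero.1 hfz⟩

lemma exp_neg_two_mul_sub_one_sq (x : ℝ) :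
    (Real.exp (-2 * x) - 1) ^ 2 = 4 * Real.exp (-2 * x) * Real.sinh x ^ 2 := by
  have h : Real.exp (-2 * x) = Real.exp (-x) ^ 2 := by
    rw [← Real.exp_nat_mul]; push_cast; ring_nf
  have h' : Real.exp (-x) * Real.exp x = 1 := by rw [← Real.exp_add]; simp
  rw [Real.sinh_eq, h]
  linear_combination
    (-(Real.exp (-x) * Real.exp x) - 1 + 2 * Real.exp (-x) ^ 2) * h'

/-- For `α > 1` and `κλ < 0`, the function
`g(v) = κ v^α (v-1)² + λ v (v^α - 1)²` has exactly one zero in `(0,1)` when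
`1 + α²λ/κ > 0`, and no zero in `(0,1)` when `1 + α²λ/κ ≤ 0`. -/
theorem stmt_15 (α : ℝ) (hα : 1 < α) (κ lam : ℝ) (hsign : κ * lam < 0)
    (g : ℝ → ℝ)
    (hg : ∀ v : ℝ, g v = κ * v ^ α * (v - 1) ^ 2 + lam * v * (v ^ α - 1) ^ 2) :
    (1 + α ^ 2 * lam / κ > 0 → ∃! v : ℝ, v ∈ Set.Ioo (0 : ℝ) 1 ∧ g v = 0) ∧
    (1 + α ^ 2 * lam / κ ≤ 0 → ∀ v ∈ Set.Ioo (0 : ℝ) 1, g v ≠ 0) := by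
  have hκ : κ ≠ 0 := by rintro rfl; simp at hsign
  have hl : lam ≠ 0 := by rintro rfl; simp at hsign
  set q := -κ / lam with hq
  have hq0 : 0 < q := by
    have h : q = -(κ * lam) / lam ^ 2 := by rw [hq]; field_simp
    rw [h]
    exact div_pos (by linarith) (by positivity)
  set c := √q with hc
  have hc0 : 0 < c := Real.sqrt_pos.2 hq0
  have hcq : c ^ 2 = q := Real.sq_sqrt hq0.le
  have hκc : κ = -lam * c ^ 2 := by rw [hcq, hq]; field_simp
  have hratio : 1 + α ^ 2 * lam / κ = (c ^ 2 - α ^ 2) / c ^ 2 := by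
    rw [hκc]; field_simp; ring
  have hzero (x : ℝ) (hx : 0 < x) :
      g (Real.exp (-2 * x)) = 0 ↔ Real.sinh (α * x) = c * Real.sinh x := by
    have hpow : Real.exp (-2 * x) ^ α = Real.exp (-2 * (α * x)) := by
      rw [← Real.exp_mul]; ring_nf
    have hs := Real.sinh_pos_iff.2 hx
    have hsα : 0 < Real.sinh (α * x) := Real.sinh_pos_iff.2 (by positivity)
    have hfac : g (Real.exp (-2 * x)) = 4 * lam * Real.exp (-2 * x) * Real.exp (-2 * (α * x)) *
        (Real.sinh (α * x) ^ 2 - (c * Real.sinh x) ^ 2) := by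
      rw [hg, hpow, exp_neg_two_mul_sub_one_sq, exp_neg_two_mul_sub_one_sq, hκc]
      ring
    rw [hfac, mul_eq_zero, sub_eq_zero, sq_eq_sq₀ hsα.le (by positivity)]
    simp [hl]
  have hparam (v : ℝ) (hv : v ∈ Set.Ioo (0 : ℝ) 1) : ∃ x, 0 < x ∧ v = Real.exp (-2 * x) := by
    refine ⟨-Real.log v / 2, by linarith [Real.log_neg hv.1 hv.2], ?_⟩
    rw [show -2 * (-Real.log v / 2) = Real.log v by ring, Real.exp_log hv.1]
  constructor
  · intro h
    rw [hratio, gt_iff_lt, div_pos_iff_of_pos_right (by positivity), sub_pos] at h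
    obtain ⟨x, hx, hxc⟩ := exists_sinh_mul_eq hα (lt_of_pow_lt_pow_left₀ 2 hc0.le h)
    refine ⟨Real.exp (-2 * x), ⟨⟨Real.exp_pos _, Real.exp_lt_one_iff.mpr (by linarith)⟩,
      (hzero x hx).2 hxc⟩, ?_⟩
    rintro v ⟨hv, hgv⟩
    obtain ⟨y, hy, rfl⟩ := hparam v hv
    have hyc := (hzero y hy).1 hgv
    have hxy : y = x := (strictMonoOn_sinh_mul_div_sinh hα).injOn hy hx (by
      simp only [hyc, hxc]
      rw [mul_div_cancel_right₀ _ (Real.sinh_pos_iff.2 hy).ne',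
        mul_div_cancel_right₀ _ (Real.sinh_pos_iff.2 hx).ne'])
    rw [hxy]
  · intro h v hv hgv
    rw [hratio, div_le_iff₀ (by positivity), zero_mul, sub_nonpos] at h
    obtain ⟨x, hx, rfl⟩ := hparam v hv
    have hxc := (hzero x hx).1 hgv
    have hcα : c ≤ α := (sq_le_sq₀ hc0.le (by linarith)).1 h
    have h1 := mul_sinh_lt_sinh_mul hα hx
    have h2 := mul_le_mul_of_nonneg_right hcα (Real.sinh_pos_iff.2 hx).le
    linarith
end
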